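/- Let n ≥ 1, let q, λ, μ ∈ ℂ with q nonzero and not a root of unity, λ ≠ 0, μ ≠ 0, and let α, β, γ ∈ ℤ_{≥0}^n with γ ≤ α, (μ;q)_{|α|+|β|−|γ|} ≠ 0 and (μ;q)_{|α|} ≠ 0. Define g_α(ζ) = ζ^{−|α|}(ζ;q)_{|α|}/∏_{i=1}^n (q;q)_{α_i}. Then g_γ(λ) g_{α+β−γ}(μ) Φ_q^{(n)}(β | α+β−γ; λ, μ) = q^{φ(α−γ, β−γ)} Φ_q^{(n)}(γ|α;λ,μ) g_α(μ) g_β(λ). -/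

import Mathlib

/-- The q-Pochhammer symbol `(z;q)_m = ∏_{j=0}^{m-1} (1 - z q^j)`. -/
noncomputable def qPoch (q z : ℂ) (m : ℕ) : ℂ := ∏ j ∈ Finset.range m, (1 - z * q ^ j)

/-- The q-binomial coefficient `binom(m,k)_q`. -/
noncomputable def qBinom (q : ℂ) (m k : ℕ) : ℂ :=
  if k ≤ m then qPoch q q m / (qPoch q q k * qPoch q q (m - k)) else 0

/-- `q` is not a root of unity. -/
def notRootOfUnity (q : ℂ) : Prop := ∀ m : ℕ, 0 < m → q ^ m ≠ 1

/-- `φ(β,γ) = Σ_{1 ≤ i < j ≤ k} β_i γ_j` for integer vectors. -/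
def phi {k : ℕ} (β γ : Fin k → ℤ) : ℤ :=
  ∑ i, ∑ j, if i < j then β i * γ j else 0

open Classical in
/-- The weight `Φ_q^{(n)}(γ|β;λ,μ)` of the stochastic R matrix of `U_q(A^{(1)}_n)`. -/
noncomputable def Phi (n : ℕ) (q lam mu : ℂ) (γ β : Fin n → ℕ) : ℂ :=
  if γ ≤ β then
    q ^ phi (fun i => (β i : ℤ) - (γ i : ℤ)) (fun i => (γ i : ℤ))
      * (mu / lam) ^ (∑ i, γ i)
      * qPoch q lam (∑ i, γ i) * qPoch q (mu / lam) ((∑ i, β i) - ∑ i, γ i)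
      * (∏ i, qBinom q (β i) (γ i)) / qPoch q mu (∑ i, β i)
  else 0


/-- `g_α(ζ) = ζ^{−|α|}(ζ;q)_{|α|} / ∏_i (q;q)_{α_i}`. -/
noncomputable def g (n : ℕ) (q zeta : ℂ) (α : Fin n → ℕ) : ℂ :=
  zeta ^ (-(∑ i, α i : ℤ)) * qPoch q zeta (∑ i, α i) / ∏ i, qPoch q q (α i)

theorem qPoch_self_ne_zero {q : ℂ} (hq : notRootOfUnity q) (m : ℕ) : qPoch q q m ≠ 0 := by
  refine Finset.prod_ne_zero_iff.2 fun j _ => sub_ne_zero.2 ?_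
  rw [← pow_succ']
  exact (hq (j + 1) j.succ_pos).symm

theorem phi_add_right {k : ℕ} (β γ γ' : Fin k → ℤ) :
    phi β (fun i => γ i + γ' i) = phi β γ + phi β γ' := by
  simp only [phi, ← Finset.sum_add_distrib]
  refine Finset.sum_congr rfl fun i _ => Finset.sum_congr rfl fun j _ => ?_
  split_ifs <;> ring

theorem prod_qBinom_add {n : ℕ} (q : ℂ) (γ δ : Fin n → ℕ) :
    ∏ i, qBinom q (γ i + δ i) (γ i) =
      (∏ i, qPoch q q (γ i + δ i)) / ((∏ i, qPoch q q (γ i)) * ∏ i, qPoch q q (δ i)) := by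
  simp [qBinom, Finset.prod_div_distrib, Finset.prod_mul_distrib]

theorem Phi_add (n : ℕ) (q lam mu : ℂ) (γ δ : Fin n → ℕ) :
    Phi n q lam mu γ (γ + δ) =
      q ^ phi (fun i => (δ i : ℤ)) (fun i => (γ i : ℤ)) * (mu / lam) ^ (∑ i, γ i)
        * qPoch q lam (∑ i, γ i) * qPoch q (mu / lam) (∑ i, δ i)
        * ((∏ i, qPoch q q (γ i + δ i)) / ((∏ i, qPoch q q (γ i)) * ∏ i, qPoch q q (δ i)))
        / qPoch q mu ((∑ i, γ i) + ∑ i, δ i) := by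
  simp [Phi, Finset.sum_add_distrib, prod_qBinom_add]

theorem g_add (n : ℕ) (q zeta : ℂ) (γ δ : Fin n → ℕ) :
    g n q zeta (γ + δ) =
      (zeta ^ ((∑ i, γ i) + ∑ i, δ i))⁻¹ * qPoch q zeta ((∑ i, γ i) + ∑ i, δ i)
        / ∏ i, qPoch q q (γ i + δ i) := by
  simp only [g, Pi.add_apply, Finset.sum_add_distrib, ← Nat.cast_sum, zpow_neg,
    zpow_natCast]

/-- The normalization identity
`g_γ(λ) g_{α+β−γ}(μ) Φ_q^{(n)}(β|α+β−γ;λ,μ)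
  = q^{φ(α−γ,β−γ)} Φ_q^{(n)}(γ|α;λ,μ) g_α(μ) g_β(λ)`. -/
theorem g_normalization (n : ℕ) (hn : 1 ≤ n) (q lam mu : ℂ) (hq0 : q ≠ 0)
    (hq : notRootOfUnity q) (hlam : lam ≠ 0) (hmu : mu ≠ 0)
    (α β γ : Fin n → ℕ) (hγ : γ ≤ α)
    (h1 : qPoch q mu ((∑ i, α i) + (∑ i, β i) - ∑ i, γ i) ≠ 0)
    (h2 : qPoch q mu (∑ i, α i) ≠ 0) :
    g n q lam γ * g n q mu (α + β - γ) * Phi n q lam mu β (α + β - γ) =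
      q ^ phi (fun i => (α i : ℤ) - (γ i : ℤ)) (fun i => (β i : ℤ) - (γ i : ℤ)) *
        Phi n q lam mu γ α * g n q mu α * g n q lam β := by
  obtain ⟨δ, rfl⟩ := exists_add_of_le hγ
  have hsub : γ + δ + β - γ = β + δ := by
    rw [add_assoc, add_tsub_cancel_left, add_comm]
  have hsum : (∑ i, (γ + δ) i) + (∑ i, β i) - ∑ i, γ i = (∑ i, β i) + ∑ i, δ i := by
    simp only [Pi.add_apply, Finset.sum_add_distrib]
    omega
  have hphi : phi (fun i => (δ i : ℤ)) (fun i => (β i : ℤ)) =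
      phi (fun i => (δ i : ℤ)) (fun i => (β i : ℤ) - (γ i : ℤ)) +
        phi (fun i => (δ i : ℤ)) (fun i => (γ i : ℤ)) := by
    rw [← phi_add_right]
    simp
  have hdiff : (fun i => ((γ + δ) i : ℤ) - (γ i : ℤ)) = fun i => (δ i : ℤ) := by
    ext i
    simp
  have hprod (f : Fin n → ℕ) : ∏ i, qPoch q q (f i) ≠ 0 :=
    Finset.prod_ne_zero_iff.2 fun i _ => qPoch_self_ne_zero hq (f i)
  rw [hsum] at h1
  simp only [Pi.add_apply, Finset.sum_add_distrib] at h2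
  rw [hsub, Phi_add, Phi_add, g_add, g_add, hdiff, hphi, zpow_add₀ hq0]
  simp only [g, ← Nat.cast_sum, zpow_neg, zpow_natCast]
  have hβ := hprod β
  have hγ' := hprod γ
  have hδ := hprod δ
  have hβδ := hprod (β + δ)
  have hγδ := hprod (γ + δ)
  simp only [Pi.add_apply] at hβδ hγδ
  simp only [div_pow, pow_add]
  generalize q ^ phi (fun i => (δ i : ℤ)) (fun i => (β i : ℤ) - (γ i : ℤ)) = x
  generalize q ^ phi (fun i => (δ i : ℤ)) (fun i => (γ i : ℤ)) = y
  generalize qPoch q (mu / lam) (∑ i, δ i) = z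
  field_simp
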